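/- arXiv:2111.07084 — 2 statements merged into one kernel-verified Lean document; each statement's English description precedes it below -/
import Mathlib

section
/- For all integers 0 ≤ a < b there exist finite sets Θ, Θ̃ ⊆ {1, 2, 3, …} and intervals J_j ⊆ ℕ (j ∈ Θ) and J̃_i ⊆ ℕ (i ∈ Θ̃) such that the interval [a, b) = {a, a+1, …, b−1} is the disjoint union {a} ∪ ⋃_{j∈Θ} J_j ∪ ⋃_{i∈Θ̃} J̃_i (all the listed sets being pairwise disjoint), and such that a ∔ J_j = δ_j for every j ∈ Θ and b ∔ J̃_i = δ_i for every i ∈ Θ̃. -/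
open MeasureTheory Real
open scoped ENNReal NNReal RealInnerProductSpace

noncomputable section

/-- The Lebesgue measure restricted to `[0,1)`. -/
def μ01 : MeasureTheory.Measure ℝ := MeasureTheory.volume.restrict (Set.Ico (0:ℝ) 1)

/-- The `k`-th Rademacher function `r_k(x) = sign (sin (2^k π x))`. -/
def rademacher (k : ℕ) (x : ℝ) : ℝ := Real.sign (Real.sin (2 ^ k * Real.pi * x))

/-- The `n`-th Walsh function: the product of `r_{k+1}` over the binary digits `k` of `n`
(so that `w_0 ≡ 1`). -/
def walsh (n : ℕ) (x : ℝ) : ℝ :=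
  ∏ k ∈ Finset.range (n + 1), if n.testBit k then rademacher (k + 1) x else 1

/-- The `n`-th Walsh coefficient `(f, w_n) = ∫_0^1 f w_n`. -/
def walshCoeff (f : ℝ → ℝ) (n : ℕ) : ℝ := ∫ x in Set.Ico (0:ℝ) 1, f x * walsh n x

/-- The Walsh spectral projection `P_A f = Σ_{n ∈ A} (f, w_n) w_n`. -/
def walshProj (A : Set ℕ) (f : ℝ → ℝ) (x : ℝ) : ℝ :=
  ∑' n : ℕ, Set.indicator A (fun m => walshCoeff f m * walsh m x) n

/-- The dyadic σ-algebra `F_k`, generated by the intervals `[i 2^{-k}, (i+1) 2^{-k})`. -/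
def dyadicSigma (k : ℕ) : MeasurableSpace ℝ :=
  MeasurableSpace.comap (fun x : ℝ => ⌊x * 2 ^ k⌋) ⊤

variable {E : Type*} [NormedAddCommGroup E] [NormedSpace ℝ E] [CompleteSpace E]

/-- `E_k f`, the conditional expectation of `f` with respect to `F_k` (over `[0,1)`). -/
def Ek (k : ℕ) (f : ℝ → E) : ℝ → E := μ01[f | dyadicSigma k]

/-- The martingale difference `Δ_k f = E_k f - E_{k-1} f` for `k ≥ 1`;
`Δ_0 f` is the constant `∫_0^1 f`. -/
def Dk (k : ℕ) (f : ℝ → E) : ℝ → E :=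
  if k = 0 then fun _ => ∫ x in Set.Ico (0:ℝ) 1, f x else Ek k f - Ek (k - 1) f

/-- `δ_k`: `δ_0 = {0}`, and `δ_k = {n : 2^{k-1} ≤ n ≤ 2^k - 1}` for `k ≥ 1`. -/
def deltaSet : ℕ → Set ℕ
  | 0 => {0}
  | (k + 1) => Set.Icc (2 ^ k) (2 ^ (k + 1) - 1)

/-- The dyadic interval `[i 2^{-k}, (i+1) 2^{-k})`. -/
def dyadicI (k i : ℕ) : Set ℝ := Set.Ico ((i : ℝ) / 2 ^ k) ((i + 1 : ℝ) / 2 ^ k)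

/-- The dyadic sharp maximal function
`g^#(x) = sup_{I ∋ x} (|I|⁻¹ ∫_I ‖g - g_I‖² )^{1/2}`, the supremum being taken over
dyadic intervals `I` containing `x`, and `g_I = |I|⁻¹ ∫_I g`. -/
def dyadicSharp (g : ℝ → E) (x : ℝ) : ℝ :=
  ⨆ q : {q : ℕ × ℕ // q.2 < 2 ^ q.1 ∧ x ∈ dyadicI q.1 q.2},
    Real.sqrt ((2:ℝ) ^ q.1.1 * ∫ t in dyadicI q.1.1 q.1.2,
      ‖g t - (2:ℝ) ^ q.1.1 • ∫ u in dyadicI q.1.1 q.1.2, g u‖ ^ 2)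

/-- The dyadic maximal function `M₂ f(x) = sup_{I ∋ x} (|I|⁻¹ ∫_I |f|²)^{1/2}`,
the supremum being taken over dyadic intervals `I` containing `x`. -/
def M2 (f : ℝ → ℝ) (x : ℝ) : ℝ :=
  ⨆ q : {q : ℕ × ℕ // q.2 < 2 ^ q.1 ∧ x ∈ dyadicI q.1 q.2},
    Real.sqrt ((2:ℝ) ^ q.1.1 * ∫ t in dyadicI q.1.1 q.1.2, f t ^ 2)

/-- The dyadic martingale square function of an `ℓ²`-valued function. -/
def sqFun (u : ℝ → lp (fun _ : ℕ => ℝ) 2) (x : ℝ) : ℝ :=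
  Real.sqrt (∑' j : ℕ, ‖Dk j u x‖ ^ 2)

end
theorem mem_deltaSet_succ {n k : ℕ} : n ∈ deltaSet (k + 1) ↔ 2 ^ k ≤ n ∧ n < 2 ^ (k + 1) := by
  have := Nat.two_pow_pos (k + 1)
  simp only [deltaSet, Set.mem_Icc]
  omega

theorem mem_deltaSet_succ_iff_log {n k : ℕ} : n ∈ deltaSet (k + 1) ↔ n ≠ 0 ∧ Nat.log 2 n = k := by
  rw [mem_deltaSet_succ]
  constructor
  · intro h
    have := Nat.two_pow_pos k
    exact ⟨by omega, Nat.log_eq_of_pow_le_of_lt_pow h.1 h.2⟩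
  · rintro ⟨h, rfl⟩
    exact ⟨Nat.pow_log_le_self 2 h, Nat.lt_pow_succ_log_self one_lt_two n⟩

theorem xor_div_two_pow (x y k : ℕ) : (x ^^^ y) / 2 ^ k = (x / 2 ^ k) ^^^ (y / 2 ^ k) := by
  simp only [← Nat.shiftRight_eq_div_pow, Nat.shiftRight_xor_distrib]

theorem xor_mem_deltaSet_succ {x y k : ℕ} :
    x ^^^ y ∈ deltaSet (k + 1) ↔ y / 2 ^ k = (x / 2 ^ k) ^^^ 1 := by
  have hone : x ^^^ y ∈ deltaSet (k + 1) ↔ (x ^^^ y) / 2 ^ k = 1 := by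
    rw [mem_deltaSet_succ, Nat.div_eq_iff (Nat.two_pow_pos k), pow_succ]
    have := Nat.two_pow_pos k
    omega
  rw [hone, xor_div_two_pow]
  constructor
  · intro h
    rw [← h, ← Nat.xor_assoc, Nat.xor_self, Nat.zero_xor]
  · intro h
    rw [h, ← Nat.xor_assoc, Nat.xor_self, Nat.zero_xor]

theorem xor_one_of_even {p : ℕ} (h : p % 2 = 0) : p ^^^ 1 = p + 1 := by
  rw [Nat.xor_one_of_even (Nat.even_iff.mpr h)]

theorem xor_one_of_odd {p : ℕ} (h : p % 2 = 1) : (p ^^^ 1) + 1 = p := by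
  rw [Nat.xor_one_of_odd (Nat.odd_iff.mpr h)]
  omega

/-- At the leading binary digit where `x` and `y` differ, `x` has digit `0` iff `x < y`. -/
theorem lt_iff_of_xor_mem_deltaSet {x y k : ℕ} (h : x ^^^ y ∈ deltaSet (k + 1)) :
    x < y ↔ x / 2 ^ k % 2 = 0 := by
  rw [xor_mem_deltaSet_succ] at h
  rcases Nat.mod_two_eq_zero_or_one (x / 2 ^ k) with hx | hx
  · rw [xor_one_of_even hx] at h
    exact iff_of_true (Nat.lt_of_div_lt_div (c := 2 ^ k) (by omega)) hx
  · have hy : y / 2 ^ k < x / 2 ^ k := by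
      have := xor_one_of_odd hx
      omega
    exact iff_of_false (Nat.lt_of_div_lt_div hy).not_gt (by omega)

/-- The leading differing digit lies below `m` iff all digits from `m` on agree. -/
theorem lt_iff_div_eq_of_xor_mem_deltaSet {x y k m : ℕ} (h : x ^^^ y ∈ deltaSet (k + 1)) :
    k < m ↔ x / 2 ^ m = y / 2 ^ m := by
  rw [← Nat.xor_eq_zero_iff, ← xor_div_two_pow, Nat.div_eq_zero_iff_lt (Nat.two_pow_pos m)]
  rw [mem_deltaSet_succ] at h
  constructor
  · intro hk
    exact h.2.trans_le (Nat.pow_le_pow_right two_pos hk)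
  · intro hm
    exact (Nat.pow_lt_pow_iff_right one_lt_two).mp (h.1.trans_lt hm)

theorem exists_xor_mem_deltaSet {x y : ℕ} (h : x ≠ y) : ∃ k, x ^^^ y ∈ deltaSet (k + 1) :=
  ⟨_, mem_deltaSet_succ_iff_log.mpr ⟨Nat.xor_ne_zero_iff.mpr h, rfl⟩⟩

theorem ordConnected_xor_preimage_deltaSet (a k : ℕ) :
    ((fun n => a ^^^ n) ⁻¹' deltaSet (k + 1)).OrdConnected := by
  have : (fun n => a ^^^ n) ⁻¹' deltaSet (k + 1) = (· / 2 ^ k) ⁻¹' {(a / 2 ^ k) ^^^ 1} := by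
    ext n
    exact xor_mem_deltaSet_succ
  rw [this]
  exact Set.ordConnected_singleton.preimage_mono fun _ _ h => Nat.div_le_div_right h

theorem self_notMem_xor_preimage_deltaSet (a k : ℕ) :
    a ∉ (fun n => a ^^^ n) ⁻¹' deltaSet (k + 1) := by
  simp [mem_deltaSet_succ_iff_log]

theorem disjoint_xor_preimage_deltaSet (a : ℕ) {k l : ℕ} (h : k ≠ l) :
    Disjoint ((fun n => a ^^^ n) ⁻¹' deltaSet (k + 1))
      ((fun n => a ^^^ n) ⁻¹' deltaSet (l + 1)) := by
  refine Set.disjoint_left.mpr fun n hk hl => h ?_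
  simp only [Set.mem_preimage, mem_deltaSet_succ_iff_log] at hk hl
  exact hk.2.symm.trans hl.2

theorem image_xor_preimage (a : ℕ) (S : Set ℕ) :
    (fun n => a ^^^ n) '' ((fun n => a ^^^ n) ⁻¹' S) = S :=
  Set.image_preimage_eq S fun n => ⟨a ^^^ n, by simp⟩

/-- (the combinatorial decomposition of an interval `[a, b)`): there are
finite sets `Θ, Θ̃ ⊆ {1, 2, …}` and intervals `J_j` (`j ∈ Θ`), `J̃_i` (`i ∈ Θ̃`) in `ℕ`
such that `[a, b)` is the disjoint union `{a} ∪ ⋃_{j∈Θ} J_j ∪ ⋃_{i∈Θ̃} J̃_i`, with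
`a ∔ J_j = δ_j` and `b ∔ J̃_i = δ_i`. -/
theorem stmt5 (a b : ℕ) (hab : a < b) :
    ∃ (Θ Θt : Finset ℕ) (J Jt : ℕ → Set ℕ),
      0 ∉ Θ ∧ 0 ∉ Θt ∧
      (∀ j ∈ Θ, (J j).OrdConnected) ∧ (∀ i ∈ Θt, (Jt i).OrdConnected) ∧
      Set.Ico a b = {a} ∪ (⋃ j ∈ Θ, J j) ∪ (⋃ i ∈ Θt, Jt i) ∧
      (∀ j ∈ Θ, a ∉ J j) ∧ (∀ i ∈ Θt, a ∉ Jt i) ∧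
      (∀ j ∈ Θ, ∀ j' ∈ Θ, j ≠ j' → Disjoint (J j) (J j')) ∧
      (∀ i ∈ Θt, ∀ i' ∈ Θt, i ≠ i' → Disjoint (Jt i) (Jt i')) ∧
      (∀ j ∈ Θ, ∀ i ∈ Θt, Disjoint (J j) (Jt i)) ∧
      (∀ j ∈ Θ, (fun n => a ^^^ n) '' J j = deltaSet j) ∧
      (∀ i ∈ Θt, (fun n => b ^^^ n) '' Jt i = deltaSet i) := by
  obtain ⟨m, hm⟩ := exists_xor_mem_deltaSet hab.ne
  have hbm : b / 2 ^ m = a / 2 ^ m + 1 := by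
    rw [xor_mem_deltaSet_succ.mp hm, xor_one_of_even ((lt_iff_of_xor_mem_deltaSet hm).mp hab)]
  refine ⟨((Finset.range m).filter fun k => a / 2 ^ k % 2 = 0).image (· + 1),
    ((Finset.range m).filter fun k => ¬ b / 2 ^ k % 2 = 0).image (· + 1),
    fun j => (fun n => a ^^^ n) ⁻¹' deltaSet j, fun i => (fun n => b ^^^ n) ⁻¹' deltaSet i,
    by simp, by simp, ?_⟩
  simp only [Finset.forall_mem_image, Finset.mem_filter, Finset.mem_range]
  refine ⟨fun k _ => ordConnected_xor_preimage_deltaSet a k,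
    fun k _ => ordConnected_xor_preimage_deltaSet b k, ?_,
    fun k _ => self_notMem_xor_preimage_deltaSet a k, ?_,
    fun k _ l _ h => disjoint_xor_preimage_deltaSet a (by omega),
    fun k _ l _ h => disjoint_xor_preimage_deltaSet b (by omega), ?_,
    fun k _ => image_xor_preimage a _, fun k _ => image_xor_preimage b _⟩
  · ext n
    simp only [Set.mem_Ico, Set.mem_union, Set.mem_singleton_iff, Set.mem_iUnion, exists_prop,
      Finset.exists_mem_image, Finset.mem_filter, Finset.mem_range, Set.mem_preimage]
    constructor
    · rintro ⟨han, hnb⟩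
      rcases eq_or_ne a n with rfl | hne
      · exact Or.inl (Or.inl rfl)
      have h₁ : a / 2 ^ m ≤ n / 2 ^ m := Nat.div_le_div_right han
      have h₂ : n / 2 ^ m ≤ b / 2 ^ m := Nat.div_le_div_right hnb.le
      rcases h₁.eq_or_lt with h | h
      · obtain ⟨k, hk⟩ := exists_xor_mem_deltaSet hne
        exact Or.inl (Or.inr ⟨k, ⟨(lt_iff_div_eq_of_xor_mem_deltaSet hk).mpr h,
          (lt_iff_of_xor_mem_deltaSet hk).mp (lt_of_le_of_ne han hne)⟩, hk⟩)
      · obtain ⟨k, hk⟩ := exists_xor_mem_deltaSet hnb.ne'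
        exact Or.inr ⟨k, ⟨(lt_iff_div_eq_of_xor_mem_deltaSet hk).mpr (by omega),
          (lt_iff_of_xor_mem_deltaSet hk).not.mp hnb.not_gt⟩, hk⟩
    · rintro ((rfl | ⟨k, ⟨hkm, hk⟩, hn⟩) | ⟨k, ⟨hkm, hk⟩, hn⟩)
      · exact ⟨le_rfl, hab⟩
      · have h := (lt_iff_div_eq_of_xor_mem_deltaSet hn).mp hkm
        exact ⟨((lt_iff_of_xor_mem_deltaSet hn).mpr hk).le,
          Nat.lt_of_div_lt_div (c := 2 ^ m) (by omega)⟩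
      · have h := (lt_iff_div_eq_of_xor_mem_deltaSet hn).mp hkm
        have hle := (lt_iff_of_xor_mem_deltaSet hn).not.mpr hk
        refine ⟨(Nat.lt_of_div_lt_div (c := 2 ^ m) (by omega)).le, ?_⟩
        refine lt_of_le_of_ne (not_lt.mp hle) ?_
        rintro rfl
        exact self_notMem_xor_preimage_deltaSet n k hn
  · intro k hk ha
    have h := (lt_iff_div_eq_of_xor_mem_deltaSet ha).mp hk.1
    omega
  · intro k hk l hl
    refine Set.disjoint_left.mpr fun n ha hb => ?_
    have h₁ := (lt_iff_div_eq_of_xor_mem_deltaSet ha).mp hk.1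
    have h₂ := (lt_iff_div_eq_of_xor_mem_deltaSet hb).mp hl.1
    omega
end

section
/- Let m ≥ 0 be an integer, let {a_s} be a family of nonnegative integers, and for each s let Θ_s ⊆ {1, 2, 3, …}. If the sets {a_s ∔ δ_j : s, j ∈ Θ_s} are pairwise disjoint (over all pairs (s, j) with j ∈ Θ_s), then the sets {⌊a_s/2^m⌋ ∔ δ_{j−m} : s, j ∈ Θ_s with j ≥ m + 1} are also pairwise disjoint. -/
open MeasureTheory Real
open scoped ENNReal NNReal RealInnerProductSpace

/-- A number lies in `δ_{k+1+m}` as soon as its quotient by `2^m` lies in `δ_{k+1}`. -/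
theorem mem_deltaSet_of_div_two_pow_mem {m k z : ℕ} (h : z / 2 ^ m ∈ deltaSet (k + 1)) :
    z ∈ deltaSet (k + m + 1) := by
  have hm : 0 < 2 ^ m := by positivity
  have hk : 0 < 2 ^ (k + 1) := by positivity
  have hkm : 0 < 2 ^ (k + m + 1) := by positivity
  obtain ⟨h₁, h₂⟩ := h
  rw [Nat.le_div_iff_mul_le hm, ← pow_add] at h₁
  have h₃ : z / 2 ^ m < 2 ^ (k + 1) := by omega
  rw [Nat.div_lt_iff_lt_mul hm, ← pow_add, Nat.add_right_comm] at h₃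
  exact ⟨h₁, by omega⟩

/-- If `x` lies in `⌊a/2^m⌋ ∔ δ_{j-m}` with `j > m`, then `2^m x` lies in `a ∔ δ_j`. -/
theorem mul_two_pow_mem_xor_image_deltaSet {m a j x : ℕ} (hj : m + 1 ≤ j)
    (hx : x ∈ (fun n => a / 2 ^ m ^^^ n) '' deltaSet (j - m)) :
    x * 2 ^ m ∈ (fun n => a ^^^ n) '' deltaSet j := by
  obtain ⟨n, hn, rfl⟩ := hx
  obtain ⟨k, rfl⟩ : ∃ k, j = k + m + 1 := ⟨j - m - 1, by omega⟩
  rw [show k + m + 1 - m = k + 1 by omega] at hn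
  refine ⟨a ^^^ (a / 2 ^ m ^^^ n) * 2 ^ m, mem_deltaSet_of_div_two_pow_mem ?_, by simp⟩
  rw [← Nat.shiftRight_eq_div_pow, Nat.shiftRight_xor_distrib, Nat.shiftRight_eq_div_pow,
    Nat.shiftRight_eq_div_pow, Nat.mul_div_cancel _ (by positivity)]
  simpa using hn

/-- if the sets `a_s ∔ δ_j` (`j ∈ Θ_s`) are pairwise disjoint over all
pairs `(s, j)`, then the sets `⌊a_s/2^m⌋ ∔ δ_{j-m}` (`j ∈ Θ_s`, `j ≥ m + 1`) are also
pairwise disjoint. -/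
theorem stmt8 {S : Type*} (m : ℕ) (a : S → ℕ) (Θ : S → Set ℕ) (hΘ : ∀ s, 0 ∉ Θ s)
    (hdis : ∀ s s' j j', j ∈ Θ s → j' ∈ Θ s' → (s, j) ≠ (s', j') →
      Disjoint ((fun n => a s ^^^ n) '' deltaSet j) ((fun n => a s' ^^^ n) '' deltaSet j')) :
    ∀ s s' j j', j ∈ Θ s → j' ∈ Θ s' → m + 1 ≤ j → m + 1 ≤ j' → (s, j) ≠ (s', j') →
      Disjoint ((fun n => a s / 2 ^ m ^^^ n) '' deltaSet (j - m))
        ((fun n => a s' / 2 ^ m ^^^ n) '' deltaSet (j' - m)) := by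
  intro s s' j j' hs hs' hj hj' hne
  rw [Set.disjoint_left]
  intro x hx hx'
  exact Set.disjoint_left.mp (hdis s s' j j' hs hs' hne)
    (mul_two_pow_mem_xor_image_deltaSet hj hx) (mul_two_pow_mem_xor_image_deltaSet hj' hx')
end
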